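/- arXiv:0902.2832 — 3 statements merged into one kernel-verified Lean document; each statement's English description precedes it below -/
import Mathlib

section
/- Let ℝ⁴ carry the standard inner product with orthonormal basis e₁, e₂, e₃, e₄, and let W be the group of all linear maps w of ℝ⁴ of the form w(eᵢ) = (−1)^{εᵢ} e_{σ(i)}, where σ is a permutation of {1,2,3,4}, each εᵢ ∈ {0,1}, and ε₁+ε₂+ε₃+ε₄ is even (the Weyl group of type D₄). If w ∈ W satisfies w(e₂ − e₃) = e₂ − e₃ and w(e₁ − e₂ + 2e₃) = e₁ − e₂ + 2e₃, then w = id. -/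
open scoped BigOperators

/-- The standard orthonormal basis `e₁, e₂, e₃, e₄` of `ℝ⁴` (0-indexed). -/
noncomputable def e (i : Fin 4) : EuclideanSpace ℝ (Fin 4) :=
  EuclideanSpace.single i (1 : ℝ)

/-- `w` belongs to the Weyl group of type `D₄`, realized concretely as the group of linear
maps `w (eᵢ) = (−1)^{εᵢ} e_{σ(i)}` with `σ ∈ S₄`, each sign `εᵢ = ±1`, and the product of the
signs equal to `1` (i.e. an even number of minus signs). -/
def InD4WeylGroup (w : EuclideanSpace ℝ (Fin 4) →ₗ[ℝ] EuclideanSpace ℝ (Fin 4)) : Prop :=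
  ∃ σ : Equiv.Perm (Fin 4), ∃ ε : Fin 4 → ℤˣ,
    (∏ i, ε i) = 1 ∧ ∀ i, w (e i) = (((ε i : ℤ) : ℝ)) • e (σ i)

theorem e_apply (i k : Fin 4) : e i k = if k = i then 1 else 0 := by
  simp [e, PiLp.single_apply]

/-- A signed basis vector equals a basis vector only if the indices agree and the sign is `1`. -/
theorem eq_and_eq_one_of_smul_e_eq {u : ℤˣ} {i j : Fin 4}
    (h : (((u : ℤ) : ℝ)) • e j = e i) : j = i ∧ u = 1 := by
  have hi := congrArg (fun v : EuclideanSpace ℝ (Fin 4) => v i) h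
  by_cases hij : i = j
  · rcases Int.units_eq_one_or u with rfl | rfl
    · exact ⟨hij.symm, rfl⟩
    · norm_num [e_apply, hij] at hi
  · simp [e_apply, hij] at hi

/-- If `w` lies in the Weyl group of type `D₄` acting on `ℝ⁴` and fixes both
`e₂ − e₃` and `e₁ − e₂ + 2e₃`, then `w = id`.  (Indices are 0-based: `e₂ − e₃ = e 1 - e 2`
and `e₁ − e₂ + 2e₃ = e 0 - e 1 + 2 • e 2`.) -/
theorem stmt2 (w : EuclideanSpace ℝ (Fin 4) →ₗ[ℝ] EuclideanSpace ℝ (Fin 4))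
    (hw : InD4WeylGroup w)
    (h1 : w (e 1 - e 2) = e 1 - e 2)
    (h2 : w (e 0 - e 1 + (2 : ℝ) • e 2) = e 0 - e 1 + (2 : ℝ) • e 2) :
    w = LinearMap.id := by
  obtain ⟨σ, ε, hε, hσ⟩ := hw
  have h_two : w (e 2) = e 2 := by
    have h := congrArg (fun v : EuclideanSpace ℝ (Fin 4) => v 2) h2
    have h02 : σ 0 ≠ σ 2 := σ.injective.ne (by decide)
    have h12 : σ 1 ≠ σ 2 := σ.injective.ne (by decide)
    have h01 : σ 0 ≠ σ 1 := σ.injective.ne (by decide)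
    simp only [map_add, map_sub, map_smul, hσ, PiLp.add_apply, PiLp.sub_apply, PiLp.smul_apply,
      smul_eq_mul, e_apply, if_neg (show (2 : Fin 4) ≠ 0 by decide),
      if_neg (show (2 : Fin 4) ≠ 1 by decide)] at h
    rw [hσ]
    by_cases hs : 2 = σ 2
    · have hs0 : 2 ≠ σ 0 := fun hc => h02 (hc.symm.trans hs)
      have hs1 : 2 ≠ σ 1 := fun hc => h12 (hc.symm.trans hs)
      simp only [← hs, if_neg hs0, if_neg hs1] at h ⊢
      rcases Int.units_eq_one_or (ε 2) with hu | hu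
      · simp [hu]
      · norm_num [hu] at h
    · exfalso
      by_cases hs0 : 2 = σ 0
      · have hs1 : 2 ≠ σ 1 := fun hc => h01 (hs0.symm.trans hc)
        rcases Int.units_eq_one_or (ε 0) with hu | hu <;>
          norm_num [if_pos hs0, if_neg hs1, if_neg hs, hu] at h
      · rcases Int.units_eq_one_or (ε 1) with hu | hu <;>
          split_ifs at h <;> norm_num [hu] at h
  have h_one : w (e 1) = e 1 := by
    rw [map_sub, h_two] at h1
    exact sub_left_injective h1
  have h_zero : w (e 0) = e 0 := by
    rw [map_add, map_sub, map_smul, h_two, h_one] at h2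
    exact sub_left_injective (add_left_injective _ h2)
  obtain ⟨hσ0, hε0⟩ := eq_and_eq_one_of_smul_e_eq ((hσ 0).symm.trans h_zero)
  obtain ⟨hσ1, hε1⟩ := eq_and_eq_one_of_smul_e_eq ((hσ 1).symm.trans h_one)
  obtain ⟨hσ2, hε2⟩ := eq_and_eq_one_of_smul_e_eq ((hσ 2).symm.trans h_two)
  have hε3 : ε 3 = 1 := by
    simpa [Fin.prod_univ_four, hε0, hε1, hε2] using hε
  have hσ3 : σ 3 = 3 := by
    have h03 : σ 3 ≠ σ 0 := σ.injective.ne (by decide)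
    have h13 : σ 3 ≠ σ 1 := σ.injective.ne (by decide)
    have h23 : σ 3 ≠ σ 2 := σ.injective.ne (by decide)
    rw [hσ0] at h03
    rw [hσ1] at h13
    rw [hσ2] at h23
    omega
  have h_three : w (e 3) = e 3 := by
    simp [hσ, hε3, hσ3]
  refine (EuclideanSpace.basisFun (Fin 4) ℝ).toBasis.ext fun i => ?_
  have hb : (EuclideanSpace.basisFun (Fin 4) ℝ).toBasis i = e i := by simp [e]
  rw [hb, LinearMap.id_apply]
  fin_cases i
  exacts [h_zero, h_one, h_two, h_three]
end

section
/- Let ℝ⁴ carry the standard inner product with orthonormal basis e₁, e₂, e₃, e₄, let W be the Weyl group of type D₄ realized as the group of linear maps w(eᵢ) = (−1)^{εᵢ} e_{σ(i)} with σ ∈ S₄, εᵢ ∈ {0,1}, Σεᵢ even, and let τ be the unique linear map of ℝ⁴ with τ(e₁−e₂) = e₃−e₄, τ(e₂−e₃) = e₂−e₃, τ(e₃−e₄) = e₃+e₄, and τ(e₃+e₄) = e₁−e₂ (the triality automorphism). Let V^τ = {v ∈ ℝ⁴ : τ(v) = v}. Then {w ∈ W : w(V^τ) = V^τ} = {w ∈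 W : τ ∘ w ∘ τ⁻¹ = w}. -/
open scoped BigOperators

/-- Twice the matrix of the triality automorphism in the basis `e`. -/
def trialityMatrix : Matrix (Fin 4) (Fin 4) ℤ :=
  !![1, 1, 1, 1; 1, 1, -1, -1; 1, -1, 1, -1; -1, 1, 1, -1]

/-- A signed permutation with an even number of signs which maps the vectors `e 0 + e 1` and
`e 0 + e 2` of the plane `x 3 = 0`, `x 0 = x 1 + x 2` into that plane commutes with
`trialityMatrix`. -/
theorem trialityMatrix_commute_of_preserves_plane :
    ∀ (ρ : Equiv.Perm (Fin 4)) (η : Fin 4 → ℤˣ), (∏ i, η i) = 1 →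
      (∀ v ∈ [![1, 1, 0, 0], ![1, 0, 1, 0]], (η 3 : ℤ) * v (ρ 3) = 0 ∧
        (η 0 : ℤ) * v (ρ 0) = η 1 * v (ρ 1) + η 2 * v (ρ 2)) →
      ∀ k l, (η k : ℤ) * trialityMatrix (ρ k) (ρ l) = trialityMatrix k l * η l := by
  decide +kernel

theorem eq_sum_smul_e (x : EuclideanSpace ℝ (Fin 4)) : x = ∑ i, x i • e i := by
  ext k
  simp [e, Pi.single_apply]

/-- An element of the Weyl group acts on coordinates by a signed permutation. -/
theorem InD4WeylGroup.exists_apply {w : EuclideanSpace ℝ (Fin 4) →ₗ[ℝ] EuclideanSpace ℝ (Fin 4)}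
    (hw : InD4WeylGroup w) :
    ∃ ρ : Equiv.Perm (Fin 4), ∃ η : Fin 4 → ℤˣ,
      (∏ i, η i) = 1 ∧ ∀ x k, w x k = ((η k : ℤ) : ℝ) * x (ρ k) := by
  obtain ⟨σ, ε, hε, hw⟩ := hw
  refine ⟨σ.symm, ε ∘ σ.symm, (Equiv.prod_comp σ.symm ε).trans hε, fun x k => ?_⟩
  obtain ⟨j, rfl⟩ := σ.surjective k
  conv_lhs => rw [eq_sum_smul_e x, map_sum]
  simp only [map_smul, hw]
  simp [e, Pi.single_apply, mul_comm]

theorem InD4WeylGroup.injective {w : EuclideanSpace ℝ (Fin 4) →ₗ[ℝ] EuclideanSpace ℝ (Fin 4)}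
    (hw : InD4WeylGroup w) : Function.Injective w := by
  obtain ⟨ρ, η, -, hw⟩ := hw.exists_apply
  intro x y hxy
  ext k
  have h := congrArg (fun z => z (ρ.symm k)) hxy
  simpa [hw] using h

section Triality

variable {τ : EuclideanSpace ℝ (Fin 4) ≃ₗ[ℝ] EuclideanSpace ℝ (Fin 4)}

theorem triality_apply (hτ1 : τ (e 0 - e 1) = e 2 - e 3) (hτ2 : τ (e 1 - e 2) = e 1 - e 2)
    (hτ3 : τ (e 2 - e 3) = e 2 + e 3) (hτ4 : τ (e 2 + e 3) = e 0 - e 1)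
    (x : EuclideanSpace ℝ (Fin 4)) (k : Fin 4) :
    τ x k = (1 / 2 : ℝ) * ∑ l, (trialityMatrix k l : ℝ) * x l := by
  have hx : x = x 0 • (e 0 - e 1) + (x 0 + x 1) • (e 1 - e 2) +
      ((x 0 + x 1 + x 2 - x 3) / 2) • (e 2 - e 3) +
      ((x 0 + x 1 + x 2 + x 3) / 2) • (e 2 + e 3) := by
    ext i
    fin_cases i <;> simp [e] <;> ring
  conv_lhs => rw [hx]
  simp only [map_add, map_smul, hτ1, hτ2, hτ3, hτ4]
  fin_cases k <;> simp [e, trialityMatrix, Fin.sum_univ_four] <;> ring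

theorem mem_ker_triality_sub_id_iff
    (hτ : ∀ x k, τ x k = (1 / 2 : ℝ) * ∑ l, (trialityMatrix k l : ℝ) * x l)
    (x : EuclideanSpace ℝ (Fin 4)) :
    x ∈ LinearMap.ker ((τ : EuclideanSpace ℝ (Fin 4) →ₗ[ℝ] EuclideanSpace ℝ (Fin 4)) -
      LinearMap.id) ↔ x 3 = 0 ∧ x 0 = x 1 + x 2 := by
  rw [LinearMap.mem_ker, LinearMap.sub_apply, sub_eq_zero, LinearEquiv.coe_coe, LinearMap.id_apply,
    PiLp.ext_iff]
  simp only [hτ, Fin.forall_fin_succ, Fin.sum_univ_four]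
  simp [trialityMatrix]
  constructor
  · rintro ⟨h0, h1, h2, h3⟩
    constructor <;> linarith
  · rintro ⟨h3, h0⟩
    refine ⟨?_, ?_, ?_, ?_⟩ <;> linarith

theorem triality_comm_of_map_ker_le
    (hτ : ∀ x k, τ x k = (1 / 2 : ℝ) * ∑ l, (trialityMatrix k l : ℝ) * x l)
    {w : EuclideanSpace ℝ (Fin 4) →ₗ[ℝ] EuclideanSpace ℝ (Fin 4)} (hw : InD4WeylGroup w)
    (h : ∀ x : EuclideanSpace ℝ (Fin 4), x 3 = 0 ∧ x 0 = x 1 + x 2 →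
      w x 3 = 0 ∧ w x 0 = w x 1 + w x 2)
    (x : EuclideanSpace ℝ (Fin 4)) : τ (w x) = w (τ x) := by
  obtain ⟨ρ, η, hη, hw⟩ := hw.exists_apply
  have key := trialityMatrix_commute_of_preserves_plane ρ η hη fun v hv => by
    have hv' : v 3 = 0 ∧ v 0 = v 1 + v 2 := by
      revert v
      decide
    have := h (WithLp.toLp 2 fun i => (v i : ℝ)) (by
      dsimp only
      exact_mod_cast hv')
    simp only [hw] at this
    exact_mod_cast this
  ext k
  rw [hτ, hw, hτ, ← Equiv.sum_comp ρ fun l => (trialityMatrix (ρ k) l : ℝ) * x l,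
    mul_left_comm]
  congr 1
  rw [Finset.mul_sum]
  refine Finset.sum_congr rfl fun l _ => ?_
  have hkl : ((η k : ℤ) : ℝ) * trialityMatrix (ρ k) (ρ l) = trialityMatrix k l * (η l : ℤ) := by
    exact_mod_cast key k l
  rw [hw, ← mul_assoc, ← mul_assoc, hkl]

end Triality

/-- Let `τ` be the triality automorphism of `ℝ⁴`, i.e. the (unique, invertible)
linear map with `τ(e₁−e₂) = e₃−e₄`, `τ(e₂−e₃) = e₂−e₃`, `τ(e₃−e₄) = e₃+e₄`,
`τ(e₃+e₄) = e₁−e₂` (indices 0-based below), and let `V^τ = ker (τ - id)` be its fixed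
subspace.  Then the set of elements of the `D₄` Weyl group `W` mapping `V^τ` onto itself
equals the set of elements of `W` commuting with `τ`, i.e. with `τ ∘ w ∘ τ⁻¹ = w`. -/
theorem stmt3 (τ : EuclideanSpace ℝ (Fin 4) ≃ₗ[ℝ] EuclideanSpace ℝ (Fin 4))
    (hτ1 : τ (e 0 - e 1) = e 2 - e 3)
    (hτ2 : τ (e 1 - e 2) = e 1 - e 2)
    (hτ3 : τ (e 2 - e 3) = e 2 + e 3)
    (hτ4 : τ (e 2 + e 3) = e 0 - e 1) :
    {w : EuclideanSpace ℝ (Fin 4) →ₗ[ℝ] EuclideanSpace ℝ (Fin 4) | InD4WeylGroup w ∧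
        Submodule.map w (LinearMap.ker ((τ : EuclideanSpace ℝ (Fin 4) →ₗ[ℝ]
            EuclideanSpace ℝ (Fin 4)) - LinearMap.id)) =
          LinearMap.ker ((τ : EuclideanSpace ℝ (Fin 4) →ₗ[ℝ]
            EuclideanSpace ℝ (Fin 4)) - LinearMap.id)} =
      {w : EuclideanSpace ℝ (Fin 4) →ₗ[ℝ] EuclideanSpace ℝ (Fin 4) | InD4WeylGroup w ∧
        (τ : EuclideanSpace ℝ (Fin 4) →ₗ[ℝ] EuclideanSpace ℝ (Fin 4)) ∘ₗ w ∘ₗ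
          (τ.symm : EuclideanSpace ℝ (Fin 4) →ₗ[ℝ] EuclideanSpace ℝ (Fin 4)) = w} := by
  have hτ := triality_apply hτ1 hτ2 hτ3 hτ4
  ext w
  refine and_congr_right fun hw => ⟨fun h => ?_, fun h => ?_⟩
  · have hcomm := triality_comm_of_map_ker_le hτ hw fun x hx => by
      rw [← mem_ker_triality_sub_id_iff hτ] at hx ⊢
      exact h.le (Submodule.mem_map_of_mem hx)
    ext1 x
    simp [hcomm]
  · refine Submodule.eq_of_le_of_finrank_eq ?_
      (Submodule.equivMapOfInjective w hw.injective _).finrank_eq.symm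
    rintro _ ⟨x, hx, rfl⟩
    have hx : τ.symm x = x := by
      rw [LinearEquiv.symm_apply_eq, eq_comm]
      simpa [sub_eq_zero] using hx
    simpa [hx, sub_eq_zero] using LinearMap.congr_fun h x
end

section
/- Let (A, 𝔪) be a Noetherian local ring and let B be a commutative ring containing A as a subring such that B is finitely generated as an A-module. Let Â and B̂ denote the 𝔪-adic completions of A and B respectively, with the canonical maps A → Â, B → B̂ and the induced map Â → B̂ extending the inclusion A ⊆ B. Then for every b ∈ B: if the image of b in B̂ lies in the image of Â → B̂, then b ∈ A. Equivalently, Â ∩ B = A inside B̂. -/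
/-- If `N / f(M)` is `I`-adically separated, an element of `N` whose image in the completion of
`N` comes from the completion of `M` lies in the range of `f`. -/
theorem AdicCompletion.mem_range_of_of_mem_range_map {R M N : Type*} [CommRing R] (I : Ideal R)
    [AddCommGroup M] [Module R M] [AddCommGroup N] [Module R N] (f : M →ₗ[R] N)
    [IsHausdorff I (N ⧸ LinearMap.range f)] {y : N}
    (hy : AdicCompletion.of I N y ∈ Set.range (AdicCompletion.map I f)) :
    y ∈ LinearMap.range f := by
  obtain ⟨x, hx⟩ := hy
  rw [← Submodule.Quotient.mk_eq_zero, ← Submodule.mkQ_apply]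
  apply AdicCompletion.of_injective I
  rw [← AdicCompletion.map_of, ← hx, AdicCompletion.map_comp_apply, LinearMap.range_mkQ_comp,
    AdicCompletion.map_zero, LinearMap.zero_apply, _root_.map_zero]

/-- Let `(A, 𝔪)` be a Noetherian local ring and `B ⊇ A` a commutative ring
extension which is finitely generated as an `A`-module.  Let `Â`, `B̂` be the `𝔪`-adic
completions, with the induced map `Â → B̂` extending `A ⊆ B`.  If `b ∈ B` is such that its
image in `B̂` lies in the image of `Â → B̂`, then `b ∈ A` (i.e. `Â ∩ B = A` inside `B̂`). -/
theorem stmt8 (B : Type*) [CommRing B] (A : Subring B)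
    [IsNoetherianRing A] [IsLocalRing A] [Module.Finite A B]
    (b : B)
    (hb : AdicCompletion.of (IsLocalRing.maximalIdeal A) B b ∈
      Set.range (AdicCompletion.map (IsLocalRing.maximalIdeal A)
        (Algebra.linearMap (↥A) B))) :
    b ∈ A := by
  obtain ⟨a, rfl⟩ := AdicCompletion.mem_range_of_of_mem_range_map _ _ hb
  exact a.2
end
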